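/- For every real number x with 0 < x < 1, Rogers' dilogarithm L(t) := −(1/2)·log(t)·log(1/(1−t)) − ∫₀ᵗ log(1−s)/s ds − π²/6 satisfies L(x) + L(1−x) = −π²/6. -/

import Mathlib

/-- Rogers' dilogarithm (normalized by subtracting `π²/6`). -/
noncomputable def rogersL (t : ℝ) : ℝ :=
  -(1/2) * Real.log t * Real.log (1 / (1 - t))
    - (∫ s in (0:ℝ)..t, Real.log (1 - s) / s) - Real.pi ^ 2 / 6

open Set Filter Topology

/-- The dilogarithm `Li₂` as a power series. -/
noncomputable def dilogSeries (t : ℝ) : ℝ := ∑' n : ℕ, t ^ (n + 1) / ((n : ℝ) + 1) ^ 2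

lemma hasSum_one_div_succ_sq :
    HasSum (fun n : ℕ => 1 / ((n : ℝ) + 1) ^ 2) (Real.pi ^ 2 / 6) := by
  have h := (hasSum_nat_add_iff' (f := fun n : ℕ => (1 : ℝ) / (n : ℝ) ^ 2) 1).2 hasSum_zeta_two
  simpa using h

lemma dilogSeries_zero : dilogSeries 0 = 0 := by
  simp [dilogSeries]

lemma dilogSeries_one : dilogSeries 1 = Real.pi ^ 2 / 6 := by
  simpa [dilogSeries] using hasSum_one_div_succ_sq.tsum_eq

lemma norm_dilogSeries_term_le (n : ℕ) {t : ℝ} (ht : t ∈ Icc (0 : ℝ) 1) :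
    ‖t ^ (n + 1) / ((n : ℝ) + 1) ^ 2‖ ≤ 1 / ((n : ℝ) + 1) ^ 2 := by
  have h0 : 0 ≤ t ^ (n + 1) := pow_nonneg ht.1 _
  rw [Real.norm_of_nonneg (by positivity)]
  gcongr
  exact pow_le_one₀ ht.1 ht.2

lemma continuousOn_dilogSeries : ContinuousOn dilogSeries (Icc 0 1) :=
  continuousOn_tsum (fun n => by fun_prop) hasSum_one_div_succ_sq.summable
    fun n _ ht => norm_dilogSeries_term_le n ht

lemma hasDerivAt_dilogSeries {t : ℝ} (ht : t ∈ Ioo (0 : ℝ) 1) :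
    HasDerivAt dilogSeries (-Real.log (1 - t) / t) t := by
  obtain ⟨r, htr, hr1⟩ := exists_between ht.2
  have hr0 : 0 < r := ht.1.trans htr
  have key : HasDerivAt dilogSeries (∑' n : ℕ, t ^ n / ((n : ℝ) + 1)) t := by
    refine hasDerivAt_tsum_of_isPreconnected (u := fun n => r ^ n) (t := Ioo 0 r)
      (y₀ := t) (g := fun (n : ℕ) (s : ℝ) => s ^ (n + 1) / ((n : ℝ) + 1) ^ 2)
      (g' := fun (n : ℕ) (s : ℝ) => s ^ n / ((n : ℝ) + 1))
      (summable_geometric_of_lt_one hr0.le hr1) isOpen_Ioo isPreconnected_Ioo ?_ ?_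
      ⟨ht.1, htr⟩ ?_ ⟨ht.1, htr⟩
    · intro n s _
      convert! (hasDerivAt_pow (n + 1) s).div_const (((n : ℝ) + 1) ^ 2) using 1
      push_cast
      field_simp
    · intro n s hs
      have h0 : 0 ≤ s ^ n := pow_nonneg hs.1.le _
      rw [Real.norm_of_nonneg (by positivity)]
      refine (div_le_self h0 (by linarith [n.cast_nonneg (α := ℝ)])).trans ?_
      exact pow_le_pow_left₀ hs.1.le hs.2.le n
    · exact Summable.of_norm_bounded hasSum_one_div_succ_sq.summable
        fun n => norm_dilogSeries_term_le n ⟨ht.1.le, ht.2.le⟩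
  convert key using 1
  have h := (Real.hasSum_pow_div_log_of_abs_lt_one
    (abs_lt.2 ⟨by linarith [ht.1], ht.2⟩)).div_const t
  rw [← h.tsum_eq]
  refine tsum_congr fun n => ?_
  have := ht.1.ne'
  field_simp
  ring

lemma integral_log_one_sub_div {t : ℝ} (ht : t ∈ Ioo (0 : ℝ) 1) :
    ∫ s in (0 : ℝ)..t, Real.log (1 - s) / s = -dilogSeries t := by
  have hcont : ContinuousOn dilogSeries (Icc 0 t) :=
    continuousOn_dilogSeries.mono (Icc_subset_Icc_right ht.2.le)
  have hderiv : ∀ s ∈ Ioo 0 t, HasDerivAt dilogSeries (-Real.log (1 - s) / s) s :=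
    fun s hs => hasDerivAt_dilogSeries ⟨hs.1, hs.2.trans ht.2⟩
  have hint : IntervalIntegrable (fun s => -Real.log (1 - s) / s) MeasureTheory.volume 0 t := by
    refine intervalIntegral.intervalIntegrable_deriv_of_nonneg (g := dilogSeries) ?_ ?_ ?_
    · rwa [uIcc_of_le ht.1.le]
    · rwa [min_eq_left ht.1.le, max_eq_right ht.1.le]
    · rw [min_eq_left ht.1.le, max_eq_right ht.1.le]
      intro s hs
      exact div_nonneg (neg_nonneg.2 (Real.log_nonpos (by linarith [hs.2, ht.2])
        (by linarith [hs.1]))) hs.1.le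
  have h := intervalIntegral.integral_eq_sub_of_hasDerivAt_of_le ht.1.le hcont hderiv hint
  simp only [neg_div, intervalIntegral.integral_neg, dilogSeries_zero, sub_zero] at h
  linarith

lemma tendsto_log_mul_log_one_sub :
    Tendsto (fun t : ℝ => Real.log t * Real.log (1 - t)) (𝓝[>] 0) (𝓝 0) := by
  have hd : HasDerivAt (fun t : ℝ => Real.log (1 - t)) (-1) 0 := by
    simpa using ((hasDerivAt_id (0 : ℝ)).const_sub 1).log (by simp)
  have h1 := hd.tendsto_slope_zero_right
  have h2 : Tendsto (fun t : ℝ => t * Real.log t) (𝓝[>] 0) (𝓝 0) :=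
    (Real.continuous_mul_log.tendsto' 0 0 (by simp)).mono_left nhdsWithin_le_nhds
  have h := h2.mul h1
  rw [zero_mul] at h
  refine h.congr' ?_
  filter_upwards [self_mem_nhdsWithin] with t ht
  have : t ≠ 0 := ne_of_gt ht
  simp
  field_simp

/-- Euler's reflection formula for the dilogarithm. -/
lemma log_mul_log_add_dilogSeries {x : ℝ} (hx : x ∈ Ioo (0 : ℝ) 1) :
    Real.log x * Real.log (1 - x) + (dilogSeries x + dilogSeries (1 - x)) = Real.pi ^ 2 / 6 := by
  set G : ℝ → ℝ := fun t =>
    Real.log t * Real.log (1 - t) + (dilogSeries t + dilogSeries (1 - t)) with hG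
  have hderiv : ∀ t ∈ Ioo (0 : ℝ) 1, HasDerivAt G 0 t := by
    intro t ht
    have h1 : (1 - t) ≠ 0 := by linarith [ht.2]
    have hsub : HasDerivAt (fun s : ℝ => 1 - s) (-1) t := by
      simpa using (hasDerivAt_id t).const_sub 1
    have hP := (hasDerivAt_dilogSeries (t := 1 - t)
      ⟨by linarith [ht.2], by linarith [ht.1]⟩).comp t hsub
    convert! ((Real.hasDerivAt_log ht.1.ne').mul (hsub.log h1)).add
      ((hasDerivAt_dilogSeries ht).add hP) using 1
    rw [sub_sub_cancel]
    have := ht.1.ne'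
    field_simp
    ring
  have hconst : ∀ t ∈ Ioo (0 : ℝ) 1, G t = G x := fun t ht =>
    isOpen_Ioo.is_const_of_deriv_eq_zero isPreconnected_Ioo
      (fun s hs => (hderiv s hs).differentiableAt.differentiableWithinAt)
      (fun s hs => (hderiv s hs).deriv) ht hx
  have hmem : Ioo (0 : ℝ) 1 ∈ 𝓝[>] (0 : ℝ) := Ioo_mem_nhdsGT one_pos
  have hlim₀ : Tendsto dilogSeries (𝓝[>] 0) (𝓝 0) := by
    have h := (continuousOn_dilogSeries 0 (by simp)).tendsto
    rw [dilogSeries_zero] at h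
    refine h.mono_left (nhdsWithin_le_of_mem (mem_of_superset hmem Ioo_subset_Icc_self))
  have hlim₁ : Tendsto (fun t => dilogSeries (1 - t)) (𝓝[>] 0) (𝓝 (Real.pi ^ 2 / 6)) := by
    have h := (continuousOn_dilogSeries 1 (by simp)).tendsto
    rw [dilogSeries_one] at h
    refine h.comp (tendsto_nhdsWithin_iff.2 ⟨?_, ?_⟩)
    · exact ((continuous_const.sub continuous_id).tendsto' (0 : ℝ) 1 (by simp)).mono_left
        nhdsWithin_le_nhds
    · filter_upwards [hmem] with t ht
      exact ⟨by linarith [ht.2], by linarith [ht.1]⟩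
  have hlim : Tendsto G (𝓝[>] 0) (𝓝 (Real.pi ^ 2 / 6)) := by
    simpa using tendsto_log_mul_log_one_sub.add (hlim₀.add hlim₁)
  have hlim' : Tendsto G (𝓝[>] 0) (𝓝 (G x)) :=
    tendsto_const_nhds.congr' (by filter_upwards [hmem] with t ht using (hconst t ht).symm)
  exact tendsto_nhds_unique hlim' hlim

theorem stmt14 (x : ℝ) (hx0 : 0 < x) (hx1 : x < 1) :
    rogersL x + rogersL (1 - x) = -(Real.pi ^ 2 / 6) := by
  have h := log_mul_log_add_dilogSeries ⟨hx0, hx1⟩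
  rw [rogersL, rogersL, integral_log_one_sub_div ⟨hx0, hx1⟩,
    integral_log_one_sub_div ⟨by linarith, by linarith⟩, sub_sub_cancel, one_div (1 - x),
    one_div x, Real.log_inv, Real.log_inv]
  linarith
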